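/- Normality of new dual EP matrices: with the Hartwig–Spindelböck decomposition data as in the context and Â^N := Û · fromBlocks(K*Σ₁⁻¹, 0, L*Σ₁⁻¹, 0) · Û* (the NDMPI of Â), if Â is new dual EP (i.e., Â·Â^N = Â^N·Â), then Â is normal (Â·Â* = Â*·Â) if and only if Σ₁·K = K·Σ₁. -/

import Mathlib

open Matrix

/-- The dual complex numbers `𝔻ℂ := ℂ[ε]`, the trivial square-zero extension of `ℂ` by `ℂ`. -/
abbrev DC := TrivSqZeroExt ℂ ℂ

/-- Star on dual complex numbers: `(a + b·ε)* = conj a + conj b · ε`. -/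
instance : Star DC :=
  ⟨fun x => ((starRingEnd ℂ) x.fst, (starRingEnd ℂ) x.snd)⟩

/-- A positive appreciable real dual number: the standard part is a positive real and
the dual part is real. -/
def PosAppreciable (x : DC) : Prop :=
  (∃ a : ℝ, 0 < a ∧ x.fst = (a : ℂ)) ∧ (∃ b : ℝ, x.snd = (b : ℂ))

/-- A nonnegative infinitesimal real dual number: the standard part is `0` and
the dual part is a nonnegative real. -/
def NonnegInfinitesimal (x : DC) : Prop :=
  x.fst = 0 ∧ ∃ b : ℝ, 0 ≤ b ∧ x.snd = (b : ℂ)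

/-- The standard part of a dual complex matrix. -/
def stdPart {m n : Type*} (X : Matrix m n DC) : Matrix m n ℂ :=
  X.map TrivSqZeroExt.fst

/-- The dual part of a dual complex matrix. -/
def dualPart {m n : Type*} (X : Matrix m n DC) : Matrix m n ℂ :=
  X.map TrivSqZeroExt.snd

instance : StarRing DC where
  star_involutive x := TrivSqZeroExt.ext (Complex.conj_conj _) (Complex.conj_conj _)
  star_mul x y := by
    refine TrivSqZeroExt.ext ?_ ?_
    · change (starRingEnd ℂ) (x * y).fst = (starRingEnd ℂ) y.fst * (starRingEnd ℂ) x.fst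
      rw [TrivSqZeroExt.fst_mul, map_mul, mul_comm]
    · change (starRingEnd ℂ) (x * y).snd =
        (starRingEnd ℂ) y.fst • (starRingEnd ℂ) x.snd +
          MulOpposite.op ((starRingEnd ℂ) x.fst) • (starRingEnd ℂ) y.snd
      simp only [TrivSqZeroExt.snd_mul, smul_eq_mul, MulOpposite.smul_eq_mul_unop,
        MulOpposite.unop_op, map_add, map_mul]
      ring
  star_add x y := TrivSqZeroExt.ext (map_add (starRingEnd ℂ) _ _) (map_add (starRingEnd ℂ) _ _)

lemma PosAppreciable.isUnit {x : DC} (hx : PosAppreciable x) : IsUnit x := by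
  obtain ⟨⟨a, ha, hxa⟩, -⟩ := hx
  rw [TrivSqZeroExt.isUnit_iff_isUnit_fst, hxa, isUnit_iff_ne_zero]
  exact_mod_cast ha.ne'

lemma PosAppreciable.add {x y : DC} (hx : PosAppreciable x) (hy : PosAppreciable y) :
    PosAppreciable (x + y) := by
  obtain ⟨⟨a, ha, hxa⟩, b, hxb⟩ := hx
  obtain ⟨⟨a', ha', hya⟩, b', hyb⟩ := hy
  exact ⟨⟨a + a', by positivity, by simp [hxa, hya]⟩, b + b', by simp [hxb, hyb]⟩

lemma PosAppreciable.star_eq {x : DC} (hx : PosAppreciable x) : star x = x := by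
  obtain ⟨⟨a, -, hxa⟩, b, hxb⟩ := hx
  refine TrivSqZeroExt.ext ?_ ?_
  · change (starRingEnd ℂ) x.fst = x.fst
    rw [hxa, Complex.conj_ofReal]
  · change (starRingEnd ℂ) x.snd = x.snd
    rw [hxb, Complex.conj_ofReal]

lemma NonnegInfinitesimal.star_mul_self {x : DC} (hx : NonnegInfinitesimal x) :
    star x * x = 0 := by
  have h : (star x).fst = 0 := by
    change (starRingEnd ℂ) x.fst = 0
    rw [hx.1, map_zero]
  refine TrivSqZeroExt.ext ?_ ?_ <;> simp [hx.1, h]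

/-- A matrix commuting with the square of a diagonal matrix commutes with the diagonal matrix
itself when sums of diagonal entries are units. -/
lemma diagonal_mul_comm_of_sq {n R : Type*} [Fintype n] [DecidableEq n] [CommRing R]
    {d : n → R} {K : Matrix n n R} (hd : ∀ i j, IsUnit (d i + d j))
    (h : diagonal d * diagonal d * K = K * (diagonal d * diagonal d)) :
    diagonal d * K = K * diagonal d := by
  ext i j
  have hij := congrFun (congrFun h i) j
  rw [diagonal_mul_diagonal, diagonal_mul, mul_diagonal] at hij
  rw [diagonal_mul, mul_diagonal]
  apply (hd i j).mul_left_cancel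
  linear_combination hij

/-- Unitary conjugation preserves and reflects commutation. -/
lemma unitary_conj_mul_comm_iff {n R : Type*} [Fintype n] [DecidableEq n] [CommRing R]
    {U V : Matrix n n R} (h : V * U = 1) (B C : Matrix n n R) :
    U * B * V * (U * C * V) = U * C * V * (U * B * V) ↔ B * C = C * B := by
  have key (X Y : Matrix n n R) : U * X * V * (U * Y * V) = U * (X * Y) * V := by
    calc U * X * V * (U * Y * V) = U * X * (V * U) * Y * V := by simp only [mul_assoc]
      _ = U * (X * Y) * V := by rw [h, mul_one]; simp only [mul_assoc]
  have cancel (X : Matrix n n R) : V * (U * X * V) * U = X := by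
    calc V * (U * X * V) * U = V * U * X * (V * U) := by simp only [mul_assoc]
      _ = X := by rw [h, one_mul, mul_one]
  rw [key, key]
  refine ⟨fun e ↦ ?_, fun e ↦ by rw [e]⟩
  rw [← cancel (B * C), e, cancel]

/-- A new dual EP matrix is normal iff `Σ₁K = KΣ₁`. -/
theorem new_dual_EP_normal_iff
    {r s : ℕ}
    -- `Û`, a unitary matrix
    (U : Matrix (Fin r ⊕ Fin s) (Fin r ⊕ Fin s) DC)
    (hU₁ : U * Uᴴ = 1) (hU₂ : Uᴴ * U = 1)
    -- the blocks `K, L, M, N` forming a unitary block matrix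
    (K : Matrix (Fin r) (Fin r) DC) (L : Matrix (Fin r) (Fin s) DC)
    (M : Matrix (Fin s) (Fin r) DC) (N : Matrix (Fin s) (Fin s) DC)
    (hW₁ : fromBlocks K L M N * (fromBlocks K L M N)ᴴ = 1)
    (hW₂ : (fromBlocks K L M N)ᴴ * fromBlocks K L M N = 1)
    -- `Σ₁` diagonal with positive appreciable real dual diagonal entries
    (S₁ : Matrix (Fin r) (Fin r) DC) (d₁ : Fin r → DC)
    (hS₁ : S₁ = Matrix.diagonal d₁) (hd₁ : ∀ i, PosAppreciable (d₁ i))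
    -- `Σ₂` diagonal with nonnegative infinitesimal real dual diagonal entries
    (S₂ : Matrix (Fin s) (Fin s) DC) (d₂ : Fin s → DC)
    (hS₂ : S₂ = Matrix.diagonal d₂) (hd₂ : ∀ i, NonnegInfinitesimal (d₂ i))
    -- the Hartwig–Spindelböck decomposition of `Â`
    (A : Matrix (Fin r ⊕ Fin s) (Fin r ⊕ Fin s) DC)
    (hA : A = U * fromBlocks (S₁ * K) (S₁ * L) (S₂ * M) (S₂ * N) * Uᴴ)
    -- `Â^N`, the NDMPI of `Â`
    (AN : Matrix (Fin r ⊕ Fin s) (Fin r ⊕ Fin s) DC)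
    (hAN : AN = U * fromBlocks (Kᴴ * S₁⁻¹) 0 (Lᴴ * S₁⁻¹) 0 * Uᴴ)
    (hEP : A * AN = AN * A) :
    A * Aᴴ = Aᴴ * A ↔ S₁ * K = K * S₁ := by
  have hS₁u : IsUnit S₁.det := by
    rw [hS₁, det_diagonal, IsUnit.prod_univ_iff]
    exact fun i ↦ (hd₁ i).isUnit
  have hS₁s : S₁ᴴ = S₁ := by
    rw [hS₁, diagonal_conjTranspose]
    exact congrArg diagonal (funext fun i ↦ (hd₁ i).star_eq)
  have hS₂s : S₂ᴴ * S₂ = 0 := by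
    rw [hS₂, diagonal_conjTranspose, diagonal_mul_diagonal, ← diagonal_zero]
    exact congrArg diagonal (funext fun i ↦ (hd₂ i).star_mul_self)
  have hS₂s' : S₂ * S₂ᴴ = 0 := by
    rw [← hS₂s, hS₂, diagonal_conjTranspose, diagonal_mul_diagonal, diagonal_mul_diagonal]
    exact congrArg diagonal (funext fun i ↦ mul_comm _ _)
  rw [fromBlocks_conjTranspose, fromBlocks_multiply, ← fromBlocks_one, fromBlocks_inj] at hW₁
  obtain ⟨hKL, hKM, hMK, hMN⟩ := hW₁
  have hAs : Aᴴ = U * (fromBlocks (S₁ * K) (S₁ * L) (S₂ * M) (S₂ * N))ᴴ * Uᴴ := by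
    rw [hA, conjTranspose_mul, conjTranspose_mul, conjTranspose_conjTranspose, Matrix.mul_assoc]
  rw [hA, hAN, unitary_conj_mul_comm_iff hU₂, fromBlocks_multiply, fromBlocks_multiply,
    fromBlocks_inj] at hEP
  obtain ⟨h₁₁, h₁₂, -, -⟩ := hEP
  have hKK : Kᴴ * K = 1 := by
    have hl : S₁ * K * (Kᴴ * S₁⁻¹) + S₁ * L * (Lᴴ * S₁⁻¹) = 1 := by
      calc _ = S₁ * (K * Kᴴ + L * Lᴴ) * S₁⁻¹ := by
            simp only [mul_add, add_mul, Matrix.mul_assoc]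
        _ = 1 := by rw [hKL, mul_one, mul_nonsing_inv _ hS₁u]
    rw [hl, Matrix.zero_mul, add_zero, Matrix.mul_assoc,
      nonsing_inv_mul_cancel_left _ _ hS₁u] at h₁₁
    exact h₁₁.symm
  have hKK' : K * Kᴴ = 1 := mul_eq_one_comm.mp hKK
  have hL : L = 0 := by
    rw [Matrix.mul_zero, Matrix.mul_zero, Matrix.zero_mul, add_zero, add_zero, Matrix.mul_assoc,
      nonsing_inv_mul_cancel_left _ _ hS₁u] at h₁₂
    rw [← Matrix.one_mul L, ← hKK', Matrix.mul_assoc, ← h₁₂, Matrix.mul_zero]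
  subst hL
  have hM : M = 0 := by
    rw [conjTranspose_zero, Matrix.mul_zero, add_zero] at hMK
    rw [← Matrix.mul_one M, ← hKK, ← Matrix.mul_assoc, hMK, Matrix.zero_mul]
  subst hM
  have hN₁ : S₂ * N * (Nᴴ * S₂ᴴ) = 0 := by
    rw [conjTranspose_zero, Matrix.mul_zero, zero_add] at hMN
    rw [Matrix.mul_assoc, ← Matrix.mul_assoc N, hMN, Matrix.one_mul, hS₂s']
  have hN₂ : Nᴴ * S₂ᴴ * (S₂ * N) = 0 := by
    rw [Matrix.mul_assoc, ← Matrix.mul_assoc S₂ᴴ, hS₂s, Matrix.zero_mul, Matrix.mul_zero]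
  have hK₁ : S₁ * K * (Kᴴ * S₁) = S₁ * S₁ := by
    rw [Matrix.mul_assoc, ← Matrix.mul_assoc K, hKK', Matrix.one_mul]
  rw [hAs, hA, unitary_conj_mul_comm_iff hU₂, fromBlocks_conjTranspose, fromBlocks_multiply,
    fromBlocks_multiply, fromBlocks_inj]
  simp only [conjTranspose_mul, conjTranspose_zero, Matrix.mul_zero, Matrix.zero_mul, add_zero,
    hS₁s, hN₁, hN₂, hK₁, and_true]
  constructor
  · intro h
    have hc : S₁ * S₁ * K = K * (S₁ * S₁) := by
      conv_rhs => rw [h]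
      simp only [← Matrix.mul_assoc, hKK', Matrix.one_mul]
    rw [hS₁] at hc ⊢
    exact diagonal_mul_comm_of_sq (fun i j ↦ ((hd₁ i).add (hd₁ j)).isUnit) hc
  · intro h
    rw [h, Matrix.mul_assoc Kᴴ, ← Matrix.mul_assoc S₁ K, h, Matrix.mul_assoc K,
      ← Matrix.mul_assoc Kᴴ, hKK, Matrix.one_mul]
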